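/- arXiv:1403.7614 — 5 statements merged into one kernel-verified Lean document; each statement's English description precedes it below -/
import Mathlib

section
/- In R = ℂ[x,y,z,a,b,c,d], let I be the ideal generated by η := xz − y², ξ₁ := ax² + bxy + cy² + dyz and ξ₂ := axy + by² + cyz + dz², and let ζ := (ax+by)·ξ₁ + (cy+dz)·ξ₂ + (acx + ady + bcy + bdz)·η. Then x·ζ ∈ I², y·ζ ∈ I² and z·ζ ∈ I², but ζ ∉ I². (Thus ζ lies in the second symbolic power of the ideal of Γ but not in its ordinary square: ζ is a new degree-2 generator of the symbolic power algebra ⊕ₙ I^{[n]}.) -/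
noncomputable section
open MvPolynomial

namespace Stmt2

/-- The polynomial ring `R = ℂ[x,y,z,a,b,c,d]`. -/
abbrev R : Type := MvPolynomial (Fin 7) ℂ

def x : R := X 0
def y : R := X 1
def z : R := X 2
def a : R := X 3
def b : R := X 4
def c : R := X 5
def d : R := X 6

/-- `η = xz − y²`. -/
def η : R := x * z - y ^ 2
/-- `ξ₁ = ax² + bxy + cy² + dyz`. -/
def ξ₁ : R := a * x ^ 2 + b * x * y + c * y ^ 2 + d * y * z
/-- `ξ₂ = axy + by² + cyz + dz²`. -/
def ξ₂ : R := a * x * y + b * y ^ 2 + c * y * z + d * z ^ 2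
/-- The unprojection element `ζ`. -/
def ζ : R := (a * x + b * y) * ξ₁ + (c * y + d * z) * ξ₂ +
    (a * c * x + a * d * y + b * c * y + b * d * z) * η

/-- The ideal `I = (η, ξ₁, ξ₂)` of the curve `Γ`. -/
def I : Ideal R := Ideal.span {η, ξ₁, ξ₂}

/-- The restriction of `R` to the line through the origin with direction `(1, 0, 0)`, at the
parameter value `(a, b, c, d) = (1, 0, 0, 0)`. -/
def restrictLine : R →ₐ[ℂ] Polynomial ℂ :=
  aeval ![Polynomial.X, 0, 0, 1, 0, 0, 0]

lemma I_le_comap_restrictLine :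
    I ≤ (Ideal.span {(Polynomial.X : Polynomial ℂ) ^ 2}).comap restrictLine := by
  rw [I, Ideal.span_le]
  rintro f (rfl | rfl | rfl) <;>
    simp [restrictLine, η, ξ₁, ξ₂, x, y, z, a, b, c, d]

lemma restrictLine_ζ : restrictLine ζ = Polynomial.X ^ 3 := by
  simp [restrictLine, ζ, η, ξ₁, ξ₂, x, y, z, a, b, c, d]
  ring

lemma ζ_notMem_I_sq : ζ ∉ I ^ 2 := by
  intro h
  have h' := Ideal.le_comap_pow restrictLine 2 (Ideal.pow_right_mono I_le_comap_restrictLine 2 h)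
  rw [Ideal.mem_comap, restrictLine_ζ, Ideal.span_singleton_pow, Ideal.mem_span_singleton,
    ← pow_mul, pow_dvd_pow_iff Polynomial.X_ne_zero Polynomial.not_isUnit_X] at h'
  omega

lemma x_mul_ζ : x * ζ = ξ₁ * ξ₁ + η * (c * ξ₁ + d * ξ₂ + b * d * η) := by
  simp only [ζ, η, ξ₁, ξ₂]
  ring

lemma y_mul_ζ : y * ζ = ξ₁ * ξ₂ + η * (-(a * d) * η) := by
  simp only [ζ, η, ξ₁, ξ₂]
  ring

lemma z_mul_ζ : z * ζ = ξ₂ * ξ₂ + η * (a * ξ₁ + b * ξ₂ + a * c * η) := by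
  simp only [ζ, η, ξ₁, ξ₂]
  ring

/-- `ζ` lies in the second symbolic power of the ideal of `Γ` but not in its
ordinary square: `x·ζ, y·ζ, z·ζ ∈ I²` but `ζ ∉ I²`. -/
theorem zeta_symbolic_not_ordinary :
    x * ζ ∈ I ^ 2 ∧ y * ζ ∈ I ^ 2 ∧ z * ζ ∈ I ^ 2 ∧ ζ ∉ I ^ 2 := by
  have hη : η ∈ I := Ideal.subset_span (by simp)
  have h₁ : ξ₁ ∈ I := Ideal.subset_span (by simp)
  have h₂ : ξ₂ ∈ I := Ideal.subset_span (by simp)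
  have comb (p q r : R) : p * ξ₁ + q * ξ₂ + r * η ∈ I :=
    add_mem (add_mem (I.mul_mem_left p h₁) (I.mul_mem_left q h₂)) (I.mul_mem_left r hη)
  refine ⟨?_, ?_, ?_, ζ_notMem_I_sq⟩
  · rw [x_mul_ζ, sq]
    exact add_mem (Ideal.mul_mem_mul h₁ h₁) (Ideal.mul_mem_mul hη (comb _ _ _))
  · rw [y_mul_ζ, sq]
    exact add_mem (Ideal.mul_mem_mul h₁ h₂) (Ideal.mul_mem_mul hη (I.mul_mem_left _ hη))
  · rw [z_mul_ζ, sq]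
    exact add_mem (Ideal.mul_mem_mul h₂ h₂) (Ideal.mul_mem_mul hη (comb _ _ _))

end Stmt2
end
end

section
/- Let a,b,c,d ∈ ℂ with a ≠ 0, let γ(w) := aw³ + bw² + cw + d, and let F := (y − zw)t + aw³ + bw² + cw + d ∈ ℂ[y,z,w,t]. Let w₀ ∈ ℂ be a root of γ and p := (0,0,w₀,0). Then: (i) F(p) = 0; (ii) the gradient of F vanishes at p if and only if w₀ is a multiple root of γ (i.e. γ′(w₀) = 0); (iii) if γ′(w₀) = 0, then the Hessian matrix of F at p has rank 3 if γ″(w₀) ≠ 0 (double root) and rank 2 if γ″(w₀) = 0 (triple root). -/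
noncomputable section
open MvPolynomial

namespace Stmt5

/-- The cubic `γ(w) = aw³ + bw² + cw + d`. -/
def γ (a b c d : ℂ) : Polynomial ℂ :=
  Polynomial.C a * Polynomial.X ^ 3 + Polynomial.C b * Polynomial.X ^ 2 +
    Polynomial.C c * Polynomial.X + Polynomial.C d

/-- `F = (y − zw)t + aw³ + bw² + cw + d` in `ℂ[y,z,w,t]`
(variables `0 = y`, `1 = z`, `2 = w`, `3 = t`). -/
def F (a b c d : ℂ) : MvPolynomial (Fin 4) ℂ :=
  (X 0 - X 1 * X 2) * X 3 + C a * X 2 ^ 3 + C b * X 2 ^ 2 + C c * X 2 + C d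

/-- The point `p = (0, 0, w₀, 0)`. -/
def p (w₀ : ℂ) : Fin 4 → ℂ := ![0, 0, w₀, 0]

/-- The Hessian matrix of `F` at `p`. -/
def hessian (a b c d w₀ : ℂ) : Matrix (Fin 4) (Fin 4) ℂ :=
  fun i j => eval (p w₀) (pderiv i (pderiv j (F a b c d)))

theorem hessian_eq (a b c d w₀ : ℂ) :
    hessian a b c d w₀ =
      !![0, 0, 0, 1;
         0, 0, 0, -w₀;
         0, 0, (Polynomial.derivative (Polynomial.derivative (γ a b c d))).eval w₀, 0;
         1, -w₀, 0, 0] := by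
  have h2 (i : Fin 4) : pderiv i (2 : MvPolynomial (Fin 4) ℂ) = 0 := (pderiv i).map_natCast 2
  have h3 (i : Fin 4) : pderiv i (3 : MvPolynomial (Fin 4) ℂ) = 0 := (pderiv i).map_natCast 3
  ext i j
  fin_cases i <;> fin_cases j <;>
    simp [hessian, F, p, γ, pderiv_X, Derivation.leibniz_pow, h2, h3]
  ring

/-- The quadratic form `2(y - uz)t + sw²` has rank `3` or `2` according to whether `s ≠ 0`. -/
theorem rank_quadratic (u s : ℂ) :
    (!![0, 0, 0, 1; 0, 0, 0, -u; 0, 0, s, 0; 1, -u, 0, 0] : Matrix (Fin 4) (Fin 4) ℂ).rank =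
      if s = 0 then 2 else 3 := by
  have hfactor : (!![0, 0, 0, 1; 0, 0, 0, -u; 0, 0, s, 0; 1, -u, 0, 0] :
      Matrix (Fin 4) (Fin 4) ℂ) =
      !![1, 0, 0, 0; -u, 1, 0, 0; 0, 0, 1, 0; 0, 0, 0, 1] * Matrix.diagonal ![1, 0, s, 1] *
        !![0, 0, 0, 1; 0, 1, 0, 0; 0, 0, 1, 0; 1, -u, 0, 0] := by
    ext i j
    fin_cases i <;> fin_cases j <;>
      simp [Matrix.mul_apply, Fin.sum_univ_four, Matrix.vecMul_diagonal]
  rw [hfactor, Matrix.rank_mul_eq_left_of_isUnit_det, Matrix.rank_mul_eq_right_of_isUnit_det,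
    Matrix.rank_diagonal, Fintype.card_subtype, Finset.card_filter, Fin.sum_univ_four]
  · split_ifs <;> simp_all
  · simp [Matrix.det_succ_row_zero, Fin.sum_univ_succ, Fin.succAbove]
  · simp [Matrix.det_succ_row_zero, Fin.sum_univ_succ, Fin.succAbove]

/-- At a root `w₀` of `γ`: (i) `F` vanishes at `p = (0,0,w₀,0)`;
(ii) the gradient of `F` vanishes at `p` iff `w₀` is a multiple root of `γ`;
(iii) if `γ'(w₀) = 0` then the Hessian of `F` at `p` has rank `3` when
`γ''(w₀) ≠ 0` and rank `2` when `γ''(w₀) = 0`. -/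
theorem singularity_type (a b c d : ℂ) (ha : a ≠ 0) (w₀ : ℂ)
    (hroot : (γ a b c d).eval w₀ = 0) :
    eval (p w₀) (F a b c d) = 0 ∧
    ((∀ i : Fin 4, eval (p w₀) (pderiv i (F a b c d)) = 0) ↔
      (Polynomial.derivative (γ a b c d)).eval w₀ = 0) ∧
    ((Polynomial.derivative (γ a b c d)).eval w₀ = 0 →
      ((Polynomial.derivative (Polynomial.derivative (γ a b c d))).eval w₀ ≠ 0 →
          (hessian a b c d w₀).rank = 3) ∧
      ((Polynomial.derivative (Polynomial.derivative (γ a b c d))).eval w₀ = 0 →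
          (hessian a b c d w₀).rank = 2)) := by
  refine ⟨?_, ?_, fun _ => ⟨fun hs => ?_, fun hs => ?_⟩⟩
  · simpa [F, γ, p] using hroot
  · simp [Fin.forall_fin_succ, F, γ, p, pderiv_X, Derivation.leibniz_pow]
    ring_nf
  · rw [hessian_eq, rank_quadratic, if_neg hs]
  · rw [hessian_eq, rank_quadratic, if_pos hs]

end Stmt5
end
end

section
/- Fix an integer n ≥ 4. In the polynomial ring ℂ[y,η,ξ₁,ξ₂,a,b,c,d,e,f], set Z := ξ₁² − (aξ₁ + dξ₂)η and F := y² + Z^{n−2} − ξ₂² − (eξ₂ + bξ₁)yη − (fξ₂ + cξ₁)Zη. Then F lies in the square of the ideal (y, ξ₁, ξ₂). Consequently, for any complex values of the coefficients a,…,f, the hypersurface {F = 0} ⊂ 𝔸⁴ with coordinates y, η, ξ₁, ξ₂ is singular at every point of the line {y = ξ₁ = ξ₂ = 0} (F and all its partial derivatives vanish there). -/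
noncomputable section
open MvPolynomial

namespace Stmt8

/-- The polynomial ring `ℂ[y,η,ξ₁,ξ₂,a,b,c,d,e,f]`
(variables `0 = y`, `1 = η`, `2 = ξ₁`, `3 = ξ₂`, `4,…,9 = a,…,f`). -/
abbrev R : Type := MvPolynomial (Fin 10) ℂ

def y : R := X 0
def η : R := X 1
def ξ₁ : R := X 2
def ξ₂ : R := X 3
def a : R := X 4
def b : R := X 5
def c : R := X 6
def d : R := X 7
def e : R := X 8
def f : R := X 9

/-- `Z = ξ₁² − (aξ₁ + dξ₂)η`. -/
def Z : R := ξ₁ ^ 2 - (a * ξ₁ + d * ξ₂) * η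
/-- `F = y² + Z^(n−2) − ξ₂² − (eξ₂ + bξ₁)yη − (fξ₂ + cξ₁)Zη`. -/
def F (n : ℕ) : R :=
  y ^ 2 + Z ^ (n - 2) - ξ₂ ^ 2 - (e * ξ₂ + b * ξ₁) * y * η - (f * ξ₂ + c * ξ₁) * Z * η

/-- A derivation maps the square of an ideal into the ideal. -/
theorem derivation_apply_mem_of_mem_sq {k A : Type*} [CommRing k] [CommRing A] [Algebra k A]
    (D : Derivation k A A) {I : Ideal A} {p : A} (hp : p ∈ I ^ 2) : D p ∈ I := by
  rw [pow_two] at hp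
  refine Submodule.mul_induction_on hp (fun u hu v hv => ?_) (fun u v hu hv => ?_)
  · rw [D.leibniz, smul_eq_mul, smul_eq_mul]
    exact I.add_mem (I.mul_mem_right _ hu) (I.mul_mem_right _ hv)
  · rw [map_add]
    exact I.add_mem hu hv

theorem F_mem_sq (n : ℕ) (hn : 4 ≤ n) : F n ∈ (Ideal.span {y, ξ₁, ξ₂} : Ideal R) ^ 2 := by
  set I : Ideal R := Ideal.span {y, ξ₁, ξ₂} with hI
  have hy : y ∈ I := Ideal.subset_span (by simp)
  have h₁ : ξ₁ ∈ I := Ideal.subset_span (by simp)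
  have h₂ : ξ₂ ∈ I := Ideal.subset_span (by simp)
  have hlin (p q : R) : p * ξ₂ + q * ξ₁ ∈ I :=
    I.add_mem (I.mul_mem_left _ h₂) (I.mul_mem_left _ h₁)
  have hZ : Z ∈ I :=
    I.sub_mem (I.pow_mem_of_mem h₁ 2 two_pos)
      (I.mul_mem_right _ (I.add_mem (I.mul_mem_left _ h₁) (I.mul_mem_left _ h₂)))
  have hmul {u v : R} (hu : u ∈ I) (hv : v ∈ I) : u * v ∈ I ^ 2 :=
    pow_two I ▸ Ideal.mul_mem_mul hu hv
  have hZn : Z ^ (n - 2) ∈ I ^ 2 :=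
    Ideal.pow_le_pow_right (by omega) (Ideal.pow_mem_pow hZ (n - 2))
  exact sub_mem (sub_mem (sub_mem (add_mem (Ideal.pow_mem_pow hy 2) hZn)
    (Ideal.pow_mem_pow h₂ 2)) (Ideal.mul_mem_right _ _ (hmul (hlin e b) hy)))
    (Ideal.mul_mem_right _ _ (hmul (hlin f c) hZ))

theorem eval_eq_zero_of_mem_span {vals : Fin 10 → ℂ} (hy : vals 0 = 0) (h₁ : vals 2 = 0)
    (h₂ : vals 3 = 0) {p : R} (hp : p ∈ Ideal.span {y, ξ₁, ξ₂}) : eval vals p = 0 := by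
  have hle : Ideal.span {y, ξ₁, ξ₂} ≤ RingHom.ker (eval vals) := by
    rw [Ideal.span_le]
    rintro q (rfl | rfl | rfl) <;> simp [RingHom.mem_ker, y, ξ₁, ξ₂, hy, h₁, h₂]
  exact hle hp

/-- `F` lies in the square of the ideal `(y, ξ₁, ξ₂)`; consequently the
hypersurface `{F = 0}` is singular along the whole line `{y = ξ₁ = ξ₂ = 0}`
for any values of the coefficients: `F` and its partial derivatives with
respect to the coordinates `y, η, ξ₁, ξ₂` all vanish there. -/
theorem F_in_square (n : ℕ) (hn : 4 ≤ n) :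
    F n ∈ (Ideal.span {y, ξ₁, ξ₂}) ^ 2 ∧
    ∀ vals : Fin 10 → ℂ, vals 0 = 0 → vals 2 = 0 → vals 3 = 0 →
      eval vals (F n) = 0 ∧
      ∀ i : Fin 10, (i : ℕ) < 4 → eval vals (pderiv i (F n)) = 0 := by
  have hF := F_mem_sq n hn
  refine ⟨hF, fun vals hy h₁ h₂ => ⟨?_, fun i _ => ?_⟩⟩
  · exact eval_eq_zero_of_mem_span hy h₁ h₂ (Ideal.pow_le_self two_ne_zero hF)
  · exact eval_eq_zero_of_mem_span hy h₁ h₂ (derivation_apply_mem_of_mem_sq (pderiv i) hF)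

end Stmt8
end
end

section
/- Let g and h be linear forms in ℂ[y,z], and let t be one of the variables y or z. Suppose that for every λ, μ ∈ ℂ the quadratic form q_{λ,μ} := x² + λ·x·h + μ·x·g + λ·t·g ∈ ℂ[x,y,z] is the square of a linear form (equivalently, has rank at most 1). Then g = 0 and h = 0. -/
noncomputable section
open MvPolynomial

namespace Stmt10

/-- The polynomial ring `ℂ[x,y,z]` (variables `0 = x`, `1 = y`, `2 = z`). -/
abbrev R : Type := MvPolynomial (Fin 3) ℂ

/-- If `x² + x(ay + bz)` is the square of a linear form, then `a = b = 0`. -/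
theorem eq_zero_of_sq_add_mul_eq_sq {a b p q r : ℂ}
    (h : (X 0 : R) ^ 2 + X 0 * (C a * X 1 + C b * X 2)
      = (C p * X 0 + C q * X 1 + C r * X 2) ^ 2) : a = 0 ∧ b = 0 := by
  have key (v : Fin 3 → ℂ) :
      v 0 ^ 2 + v 0 * (a * v 1 + b * v 2) = (p * v 0 + q * v 1 + r * v 2) ^ 2 := by
    simpa using congrArg (eval v) h
  have hq : q = 0 := by simpa using (key ![0, 1, 0]).symm
  have hr : r = 0 := by simpa using (key ![0, 0, 1]).symm
  subst hq hr
  have h₀ : 1 = p ^ 2 := by simpa using key ![1, 0, 0]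
  have h₁ : 1 + a = p ^ 2 := by simpa using key ![1, 1, 0]
  have h₂ : 1 + b = p ^ 2 := by simpa using key ![1, 0, 1]
  exact ⟨by linear_combination h₁ - h₀, by linear_combination h₂ - h₀⟩

/-- If the linear forms `g = g₁y + g₂z` and `h = h₁y + h₂z` in `ℂ[y,z]` are such
that, for `t` one of the variables `y` or `z`, the quadratic form
`q = x² + λxh + μxg + λtg` is the square of a linear form for every `λ, μ ∈ ℂ`,
then `g = 0` and `h = 0`. -/
theorem linear_parts_vanish (g₁ g₂ h₁ h₂ : ℂ) (t : R)
    (ht : t = X 1 ∨ t = X 2)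
    (hsq : ∀ l m : ℂ, ∃ p q r : ℂ,
      (X 0 : R) ^ 2 + C l * X 0 * (C h₁ * X 1 + C h₂ * X 2)
          + C m * X 0 * (C g₁ * X 1 + C g₂ * X 2)
          + C l * t * (C g₁ * X 1 + C g₂ * X 2)
        = (C p * X 0 + C q * X 1 + C r * X 2) ^ 2) :
    (C g₁ * X 1 + C g₂ * X 2 : R) = 0 ∧ (C h₁ * X 1 + C h₂ * X 2 : R) = 0 := by
  obtain ⟨p, q, r, hg⟩ := hsq 0 1
  obtain ⟨rfl, rfl⟩ := eq_zero_of_sq_add_mul_eq_sq (a := g₁) (b := g₂) (by simpa using hg)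
  obtain ⟨p, q, r, hh⟩ := hsq 1 0
  obtain ⟨rfl, rfl⟩ := eq_zero_of_sq_add_mul_eq_sq (a := h₁) (b := h₂) (by simpa using hh)
  simp

end Stmt10
end
end

section
/- Let a₀, b₀, d₀, e₀ ∈ ℂ and for λ, μ ∈ ℂ let q_{λ,μ} := xz + λ·x·(a₀x + b₀y) + μ·(a₀xy + b₀y² + d₀yz + e₀z²) ∈ ℂ[x,y,z]. Then q_{λ,μ} has rank at most 2 as a quadratic form for all λ, μ ∈ ℂ if and only if either (a₀ = 0 and b₀ = 0) or (b₀ = 0, d₀ = 0 and e₀ = 0). In the first case q_{λ,μ} = z·(x + μd₀y + μe₀z), and in the second case q_{λ,μ} = x·(z + λa₀x + μa₀y). -/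
noncomputable section
open MvPolynomial

namespace Stmt12

/-- The polynomial ring `ℂ[x,y,z]` (variables `0 = x`, `1 = y`, `2 = z`). -/
abbrev R : Type := MvPolynomial (Fin 3) ℂ

/-- The quadratic term
`q = xz + λx(a₀x + b₀y) + μ(a₀xy + b₀y² + d₀yz + e₀z²)` of the general
hypersurface section through `Γ` in the `A₂¹` case. -/
def q (a₀ b₀ d₀ e₀ l m : ℂ) : R :=
  X 0 * X 2 + C l * (X 0 * (C a₀ * X 0 + C b₀ * X 1)) +
    C m * (C a₀ * X 0 * X 1 + C b₀ * X 1 ^ 2 + C d₀ * X 1 * X 2 + C e₀ * X 2 ^ 2)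

/-- The symmetric `3×3` matrix associated to the quadratic form `q`. -/
def M (a₀ b₀ d₀ e₀ l m : ℂ) : Matrix (Fin 3) (Fin 3) ℂ :=
  !![l * a₀, (l * b₀ + m * a₀) / 2, 1 / 2;
     (l * b₀ + m * a₀) / 2, m * b₀, m * d₀ / 2;
     1 / 2, m * d₀ / 2, m * e₀]

/-- A square matrix over a field fails to have full rank iff its determinant vanishes. -/
theorem rank_lt_card_iff_det_eq_zero {n K : Type*} [Fintype n] [DecidableEq n] [Field K]
    (A : Matrix n n K) : A.rank < Fintype.card n ↔ A.det = 0 := by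
  rw [← not_iff_not, not_lt, ← ne_eq, ← isUnit_iff_ne_zero, ← Matrix.isUnit_iff_isUnit_det]
  refine ⟨fun h => ?_, fun h => (Matrix.rank_of_isUnit A h).ge⟩
  rw [← Matrix.linearIndependent_rows_iff_isUnit, linearIndependent_iff_card_le_finrank_span,
    Set.finrank, ← Matrix.rank_eq_finrank_span_row]
  exact h

theorem four_mul_det_M (a₀ b₀ d₀ e₀ l m : ℂ) :
    4 * (M a₀ b₀ d₀ e₀ l m).det =
      4 * l * m ^ 2 * a₀ * b₀ * e₀ + m * d₀ * (l * b₀ + m * a₀) - l * m ^ 2 * a₀ * d₀ ^ 2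
        - m * e₀ * (l * b₀ + m * a₀) ^ 2 - m * b₀ := by
  simp only [M, Matrix.det_fin_three, Matrix.of_apply, Matrix.cons_val]
  ring

theorem rank_M_le_two_iff (a₀ b₀ d₀ e₀ l m : ℂ) :
    (M a₀ b₀ d₀ e₀ l m).rank ≤ 2 ↔
      4 * l * m ^ 2 * a₀ * b₀ * e₀ + m * d₀ * (l * b₀ + m * a₀) - l * m ^ 2 * a₀ * d₀ ^ 2
        - m * e₀ * (l * b₀ + m * a₀) ^ 2 - m * b₀ = 0 := by
  have h := rank_lt_card_iff_det_eq_zero (M a₀ b₀ d₀ e₀ l m)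
  rw [Fintype.card_fin, Nat.lt_succ_iff] at h
  simp [h, ← four_mul_det_M]

/-- `q_{λ,μ}` has rank at most `2` as a quadratic form for all `λ, μ` iff either
`a₀ = b₀ = 0` or `b₀ = d₀ = e₀ = 0`; in the first case
`q = z(x + μd₀y + μe₀z)` and in the second `q = x(z + λa₀x + μa₀y)`. -/
theorem rank_le_two_dichotomy (a₀ b₀ d₀ e₀ : ℂ) :
    ((∀ l m : ℂ, (M a₀ b₀ d₀ e₀ l m).rank ≤ 2) ↔
      ((a₀ = 0 ∧ b₀ = 0) ∨ (b₀ = 0 ∧ d₀ = 0 ∧ e₀ = 0))) ∧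
    ((a₀ = 0 ∧ b₀ = 0) → ∀ l m : ℂ,
      q a₀ b₀ d₀ e₀ l m = X 2 * (X 0 + C (m * d₀) * X 1 + C (m * e₀) * X 2)) ∧
    ((b₀ = 0 ∧ d₀ = 0 ∧ e₀ = 0) → ∀ l m : ℂ,
      q a₀ b₀ d₀ e₀ l m = X 0 * (X 2 + C (l * a₀) * X 0 + C (m * a₀) * X 1)) := by
  refine ⟨?_, ?_, ?_⟩
  · simp only [rank_M_le_two_iff]
    constructor
    · intro h
      have h₁ := h 0 1
      have h₂ := h 0 (-1)
      have h₃ := h 0 2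
      have hb : b₀ = 0 := by linear_combination (-1) * h₁ + (1 / 3) * h₂ + (1 / 6) * h₃
      have had : a₀ * d₀ = 0 := by linear_combination (1 / 2) * h₁ + (1 / 2) * h₂
      have hae : a₀ ^ 2 * e₀ = 0 := by linear_combination had - h₁ - hb
      by_cases ha : a₀ = 0
      · exact Or.inl ⟨ha, hb⟩
      · exact Or.inr ⟨hb, (mul_eq_zero.1 had).resolve_left ha,
          (mul_eq_zero.1 hae).resolve_left (pow_ne_zero 2 ha)⟩
    · rintro (⟨rfl, rfl⟩ | ⟨rfl, rfl, rfl⟩) l m <;> ring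
  · rintro ⟨rfl, rfl⟩ l m
    simp only [q, C_mul, C_0]
    ring
  · rintro ⟨rfl, rfl, rfl⟩ l m
    simp only [q, C_mul, C_0]
    ring

end Stmt12
end
end
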